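/- Let B ∈ 𝒜 be an event with P(B) > 0 (representing the treatment event {A = a}), and let Q be the law of X under the conditional probability P(· | B). Then Q ≪ P_X, with (dQ/dP_X)(X) = E_P[1_B | σ(X)] / P(B) P-almost surely; and E_P[1_B | σ(X)] is P-almost surely equal to a σ(φ∘X)-measurable function if and only if (dQ/dP_X)(X) is P-almost surely equal to a σ(φ∘X)-measurable function. In particular, φ is a balancing score for the problem with source P_X and target Q if and only if the propensity score x ↦ P(B | X = x) is P_X-almost surely a function of φ. -/

import Mathlib

open MeasureTheory ProbabilityTheory ENNReal

noncomputable section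

/-- Let `B` be an event with `P(B) > 0` and `Q` the law of `X` under `P(·|B)`.
Then `Q ≪ P_X` with `(dQ/dP_X)(X) = E_P[1_B|σ(X)]/P(B)` `P`-a.s.; `E_P[1_B|σ(X)]` is
`P`-a.s. equal to a `σ(φ∘X)`-measurable function iff `(dQ/dP_X)(X)` is; and `φ` is a
balancing score for source `P_X` and target `Q` iff the propensity score is
`P_X`-a.s. a function of `φ`. -/
theorem cond_law_balancing_score_iff_propensity_function_of_rep
    {Ω 𝒳 Z : Type*} [MeasurableSpace Ω] [MeasurableSpace 𝒳] [MeasurableSpace Z]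
    (P : Measure Ω) [IsProbabilityMeasure P]
    (X : Ω → 𝒳) (hX : Measurable X)
    (φ : 𝒳 → Z) (hφ : Measurable φ)
    (B : Set Ω) (hB : MeasurableSet B) (hBpos : 0 < P B)
    (e : 𝒳 → ℝ) (he_meas : Measurable e)
    (he : (fun ω => e (X ω)) =ᵐ[P]
      P[B.indicator (fun _ => (1 : ℝ)) | MeasurableSpace.comap X inferInstance]) :
    Measure.map X (P[|B]) ≪ P.map X ∧
    (fun ω => ((Measure.map X (P[|B])).rnDeriv (P.map X) (X ω)).toReal)
      =ᵐ[P] (fun ω =>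
        (P[B.indicator (fun _ => (1 : ℝ)) | MeasurableSpace.comap X inferInstance]) ω
          / (P B).toReal) ∧
    ((∃ h : Ω → ℝ,
        Measurable[MeasurableSpace.comap (fun ω' => φ (X ω')) inferInstance] h ∧
        P[B.indicator (fun _ => (1 : ℝ)) | MeasurableSpace.comap X inferInstance] =ᵐ[P] h)
      ↔ (∃ h : Ω → ℝ,
        Measurable[MeasurableSpace.comap (fun ω' => φ (X ω')) inferInstance] h ∧
        (fun ω => ((Measure.map X (P[|B])).rnDeriv (P.map X) (X ω)).toReal) =ᵐ[P] h)) ∧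
    ((∃ g : Z → ℝ, Measurable g ∧
        (fun x => ((Measure.map X (P[|B])).rnDeriv (P.map X) x).toReal)
          =ᵐ[P.map X] fun x => g (φ x))
      ↔ (∃ g : Z → ℝ, Measurable g ∧ e =ᵐ[P.map X] fun x => g (φ x))) := by
  have hm : MeasurableSpace.comap X inferInstance ≤ (inferInstance : MeasurableSpace Ω) :=
    hX.comap_le
  have hb0 : (P B).toReal ≠ 0 := (ENNReal.toReal_pos hBpos.ne' (measure_ne_top P B)).ne'
  have hb : 0 < (P B).toReal := ENNReal.toReal_pos hBpos.ne' (measure_ne_top P B)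
  have hint : Integrable (B.indicator (fun _ => (1 : ℝ))) P :=
    (integrable_const (1 : ℝ)).indicator hB
  have hnn : 0 ≤ᵐ[P] fun ω => e (X ω) := by
    have h0 : 0 ≤ᵐ[P] P[B.indicator (fun _ => (1 : ℝ)) | MeasurableSpace.comap X inferInstance] :=
      condExp_nonneg (Filter.Eventually.of_forall fun ω =>
        Set.indicator_nonneg (fun _ _ => zero_le_one) ω)
    filter_upwards [h0, he] with ω h1 h2
    rw [h2]; exact h1
  have heint : Integrable (fun ω => e (X ω)) P := integrable_condExp.congr he.symm
  have hfm : Measurable (fun x => ENNReal.ofReal (e x / (P B).toReal)) :=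
    (he_meas.div_const _).ennreal_ofReal
  have hQ : Measure.map X (P[|B])
      = (P.map X).withDensity (fun x => ENNReal.ofReal (e x / (P B).toReal)) := by
    ext S hS
    rw [Measure.map_apply hX hS, withDensity_apply _ hS, setLIntegral_map hS hfm hX,
      cond_apply hB]
    have hI : ∫ ω in X ⁻¹' S, e (X ω) ∂P = (P (B ∩ X ⁻¹' S)).toReal := by
      rw [setIntegral_congr_ae (hX hS) (g :=
        P[B.indicator (fun _ => (1 : ℝ)) | MeasurableSpace.comap X inferInstance])
        (he.mono fun ω h _ => h), setIntegral_condExp hm hint ⟨S, hS, rfl⟩,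
        integral_indicator hB, Measure.restrict_restrict hB]
      simp [Measure.real]
    rw [← ofReal_integral_eq_lintegral_ofReal, integral_div, hI,
      ENNReal.ofReal_div_of_pos hb, ENNReal.ofReal_toReal (measure_ne_top _ _),
      ENNReal.ofReal_toReal (measure_ne_top _ _), ENNReal.div_eq_inv_mul]
    · exact (heint.div_const _).integrableOn
    · refine ae_restrict_of_ae ?_
      filter_upwards [hnn] with ω h
      exact div_nonneg h hb.le
  have hac : Measure.map X (P[|B]) ≪ P.map X := by
    rw [hQ]; exact withDensity_absolutelyContinuous _ _
  haveI : IsProbabilityMeasure (P.map X) := Measure.isProbabilityMeasure_map hX.aemeasurable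
  have hnn' : ∀ᵐ x ∂(P.map X), 0 ≤ e x :=
    (ae_map_iff hX.aemeasurable (measurableSet_le measurable_const he_meas)).2 hnn
  have hrn : (fun x => ((Measure.map X (P[|B])).rnDeriv (P.map X) x).toReal)
      =ᵐ[P.map X] fun x => e x / (P B).toReal := by
    have h1 := Measure.rnDeriv_withDensity (P.map X) hfm
    rw [← hQ] at h1
    filter_upwards [h1, hnn'] with x hx h0
    rw [hx, ENNReal.toReal_ofReal (div_nonneg h0 hb.le)]
  have hrnX : (fun ω => ((Measure.map X (P[|B])).rnDeriv (P.map X) (X ω)).toReal)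
      =ᵐ[P] (fun ω =>
        (P[B.indicator (fun _ => (1 : ℝ)) | MeasurableSpace.comap X inferInstance]) ω
          / (P B).toReal) := by
    filter_upwards [ae_of_ae_map hX.aemeasurable hrn, he] with ω h1 h2
    rw [h1, h2]
  refine ⟨hac, hrnX, ⟨?_, ?_⟩, ⟨?_, ?_⟩⟩
  · rintro ⟨h, hh, hE⟩
    refine ⟨fun ω => h ω / (P B).toReal, hh.div_const _, ?_⟩
    filter_upwards [hrnX, hE] with ω h1 h2
    rw [h1, h2]
  · rintro ⟨h, hh, hE⟩
    refine ⟨fun ω => h ω * (P B).toReal, hh.mul_const _, ?_⟩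
    filter_upwards [hrnX, hE] with ω h1 h2
    rw [← h2, h1, div_mul_cancel₀ _ hb0]
  · rintro ⟨g, hg, hE⟩
    refine ⟨fun z => g z * (P B).toReal, hg.mul_const _, ?_⟩
    filter_upwards [hrn, hE] with x h1 h2
    rw [← h2, h1, div_mul_cancel₀ _ hb0]
  · rintro ⟨g, hg, hE⟩
    refine ⟨fun z => g z / (P B).toReal, hg.div_const _, ?_⟩
    filter_upwards [hrn, hE] with x h1 h2
    rw [h1, h2]

end
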